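/- For any real s ≥ 0, there exists a finite set 𝒮 of low-defect pairs satisfying: (1) for any leader n with δ(n) < s, some low-defect pair in 𝒮 efficiently 3-represents n; (2) each pair (f,C) ∈ 𝒮 satisfies δ(f,C) ≤ s, and hence deg f ≤ ⌊s⌋; moreover if f has degree 0 then δ(f,C) < s. -/

import Mathlib

/-- `CpxW n k` : the positive integer `n` can be written using exactly `k` ones,
with an arbitrary combination of additions and multiplications. -/
inductive CpxW : ℕ → ℕ → Prop
  | one : CpxW 1 1
  | add {a b m n : ℕ} : CpxW a m → CpxW b n → CpxW (a + b) (m + n)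
  | mul {a b m n : ℕ} : CpxW a m → CpxW b n → CpxW (a * b) (m + n)

/-- The integer complexity `‖n‖`: the least number of 1's needed to write `n`
using additions and multiplications. -/
noncomputable def cpx (n : ℕ) : ℕ := sInf {k | CpxW n k}

/-- The defect `δ(n) = ‖n‖ - 3 log₃ n`. -/
noncomputable def defect (n : ℕ) : ℝ := (cpx n : ℝ) - 3 * Real.logb 3 (n : ℝ)

/-- `LDP r f C` : `(f, C)` is a low-defect pair of degree `r`; here a low-defect
polynomial of degree `r` is written in the variables `X 0, …, X (r-1)`. -/
inductive LDP : ℕ → MvPolynomial ℕ ℤ → ℕ → Prop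
  | const (k C : ℕ) (hk : 0 < k) (hC : cpx k ≤ C) :
      LDP 0 (MvPolynomial.C (k : ℤ)) C
  | mul {r₁ r₂ : ℕ} {f₁ f₂ : MvPolynomial ℕ ℤ} {C₁ C₂ : ℕ} :
      LDP r₁ f₁ C₁ → LDP r₂ f₂ C₂ →
      LDP (r₁ + r₂) (f₁ * MvPolynomial.rename (· + r₁) f₂) (C₁ + C₂)
  | step {r : ℕ} {f : MvPolynomial ℕ ℤ} {C : ℕ} (c D : ℕ) (hc : 0 < c) (hD : cpx c ≤ D) :
      LDP r f C → LDP (r + 1) (f * MvPolynomial.X r + MvPolynomial.C (c : ℤ)) (C + D)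

/-- A low-defect polynomial: the first component of some low-defect pair. -/
def LowDefectPoly (f : MvPolynomial ℕ ℤ) : Prop := ∃ r C, LDP r f C

/-- The leading coefficient of a low-defect polynomial of degree `r`:
the coefficient of `x₁ ⋯ x_r`. -/
noncomputable def leadCoeff (r : ℕ) (f : MvPolynomial ℕ ℤ) : ℤ :=
  MvPolynomial.coeff (∑ i ∈ Finset.range r, Finsupp.single i 1) f

/-- The defect `δ(f,C) = C - 3 log₃ a` of a low-defect pair of degree `r`,
where `a` is the leading coefficient. -/
noncomputable def pairDft (r : ℕ) (f : MvPolynomial ℕ ℤ) (C : ℕ) : ℝ :=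
  (C : ℝ) - 3 * Real.logb 3 ((leadCoeff r f : ℤ) : ℝ)

/-- `f(3^{k₁}, …, 3^{k_r})` for a polynomial of degree `r`. -/
noncomputable def eval3 (r : ℕ) (f : MvPolynomial ℕ ℤ) (k : ℕ → ℕ) : ℤ :=
  MvPolynomial.eval (fun i => if i < r then (3 : ℤ) ^ (k i) else 1) f

/-- `δ_{f,C}(k₁,…,k_r) = C + 3(k₁+⋯+k_r) - 3 log₃ f(3^{k₁},…,3^{k_r})`. -/
noncomputable def dftF (r : ℕ) (f : MvPolynomial ℕ ℤ) (C : ℕ) (k : ℕ → ℕ) : ℝ :=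
  (C : ℝ) + 3 * (∑ i ∈ Finset.range r, (k i : ℝ))
    - 3 * Real.logb 3 ((eval3 r f k : ℤ) : ℝ)

/-- The nesting order: `NestLe f i j` means `xᵢ ⪯ xⱼ`, i.e. every monomial of `f`
divisible by `xᵢ` is divisible by `xⱼ`. -/
def NestLe (f : MvPolynomial ℕ ℤ) (i j : ℕ) : Prop :=
  ∀ m ∈ f.support, m i ≠ 0 → m j ≠ 0

/-- `xᵢ` is a variable of (the degree-`r` polynomial) `f` that is minimal with
respect to the nesting order. -/
def IsMinVar (r : ℕ) (f : MvPolynomial ℕ ℤ) (i : ℕ) : Prop :=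
  i < r ∧ ∀ j < r, NestLe f j i → NestLe f i j

/-- Substituting `3^k` for the variable `xᵢ` of `f`, renumbering the later
variables down by one. -/
noncomputable def truncAt (f : MvPolynomial ℕ ℤ) (i k : ℕ) : MvPolynomial ℕ ℤ :=
  MvPolynomial.aeval (fun j => if j < i then MvPolynomial.X j
    else if j = i then MvPolynomial.C ((3 : ℤ) ^ k) else MvPolynomial.X (j - 1)) f

/-- A direct truncation of a "pair with degree" `(r, f, C)`: substitute `3^k`
into a variable of `f` minimal in the nesting order. -/
def DirectTrunc (a b : ℕ × MvPolynomial ℕ ℤ × ℕ) : Prop :=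
  ∃ i k : ℕ, a.1 = b.1 + 1 ∧ IsMinVar a.1 a.2.1 i ∧
    b.2.1 = truncAt a.2.1 i k ∧ b.2.2 = a.2.2 + 3 * k

/-- `n` is a leader: either `3 ∤ n`, or `3 ∣ n` and `‖n‖ < ‖n/3‖ + 3`. -/
def IsLeader (n : ℕ) : Prop := 0 < n ∧ (3 ∣ n → cpx n < cpx (n / 3) + 3)

/-- `(f, C)` (of degree `r`) efficiently 3-represents `n`. -/
def EffRep (r : ℕ) (f : MvPolynomial ℕ ℤ) (C : ℕ) (n : ℕ) : Prop :=
  ∃ k : ℕ → ℕ, (n : ℤ) = eval3 r f k ∧ cpx n = C + 3 * ∑ i ∈ Finset.range r, k i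

/-- The number of `∗`-entries (free coordinates) of `p` among `0, …, r-1`. -/
def starCount (r : ℕ) (p : ℕ → Option ℕ) : ℕ :=
  ((Finset.range r).filter (fun i => p i = none)).card

/-- The 3-substitution of a tuple `p ∈ (ℤ≥0 ∪ {∗})^r` into `f`: substitute
`3^{kᵢ}` for `xᵢ` whenever `p i = some kᵢ`, renumbering the surviving variables
in increasing order. -/
noncomputable def subst3 (f : MvPolynomial ℕ ℤ) (p : ℕ → Option ℕ) : MvPolynomial ℕ ℤ :=
  MvPolynomial.aeval (fun j =>
    match p j with
    | some k => MvPolynomial.C ((3 : ℤ) ^ k)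
    | none => MvPolynomial.X (((Finset.range j).filter (fun i => p i = none)).card)) f

/-- The insertion map `ι` associated to `p`: inserts the arguments into the
coordinates of `p` equal to `∗`. -/
def iotaMap (p : ℕ → Option ℕ) (ℓ : ℕ → ℕ) : ℕ → ℕ := fun j =>
  match p j with
  | some k => k
  | none => ℓ (((Finset.range j).filter (fun i => p i = none)).card)

/-! ### Integer complexity -/

theorem CpxW.pos {n k : ℕ} (h : CpxW n k) : 0 < n ∧ 0 < k := by
  induction h with
  | one => simp
  | add _ _ ih₁ ih₂ => omega
  | mul _ _ ih₁ ih₂ => exact ⟨Nat.mul_pos ih₁.1 ih₂.1, by omega⟩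

theorem CpxW.self {n : ℕ} (hn : 0 < n) : CpxW n n := by
  induction n, hn using Nat.le_induction with
  | base => exact .one
  | succ n _ ih => exact .add ih .one

theorem CpxW.cube_le {n k : ℕ} (h : CpxW n k) : n ^ 3 ≤ 3 ^ k := by
  have key : ∀ {b k : ℕ}, 0 < b → 0 < k → b ^ 3 ≤ 3 ^ k → (1 + b) ^ 3 ≤ 3 * 3 ^ k := by
    intro b k hb hk h
    have h3 : 3 ^ k = 3 * 3 ^ (k - 1) := by rw [← pow_succ']; congr 1; omega
    obtain rfl | rfl | hb : b = 1 ∨ b = 2 ∨ 3 ≤ b := by omega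
    · have := Nat.one_le_pow (k - 1) 3 (by norm_num)
      omega
    · omega
    · refine le_trans ?_ (Nat.mul_le_mul_left 3 h)
      obtain ⟨d, rfl⟩ := Nat.exists_eq_add_of_le hb
      ring_nf
      nlinarith [Nat.zero_le (d ^ 2), Nat.zero_le (d ^ 3)]
  induction h with
  | one => norm_num
  | mul _ _ ih₁ ih₂ => rw [mul_pow, pow_add]; exact Nat.mul_le_mul ih₁ ih₂
  | @add a b m n h₁ h₂ ih₁ ih₂ =>
    have p₁ := h₁.pos
    have p₂ := h₂.pos
    have one_le : 3 ≤ 3 ^ m ∧ 3 ≤ 3 ^ n :=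
      ⟨Nat.le_self_pow (by omega) 3, Nat.le_self_pow (by omega) 3⟩
    rw [pow_add]
    by_cases ha : a = 1
    · subst ha
      exact (key p₂.1 p₂.2 ih₂).trans (Nat.mul_le_mul_right _ one_le.1)
    by_cases hb : b = 1
    · subst hb
      rw [add_comm, mul_comm]
      exact (key p₁.1 p₁.2 ih₁).trans (Nat.mul_le_mul_right _ one_le.2)
    have hab : a + b ≤ a * b := by
      obtain ⟨c, rfl⟩ := Nat.exists_eq_add_of_le (show 2 ≤ a by omega)
      obtain ⟨d, rfl⟩ := Nat.exists_eq_add_of_le (show 2 ≤ b by omega)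
      nlinarith
    calc (a + b) ^ 3 ≤ (a * b) ^ 3 := Nat.pow_le_pow_left hab 3
      _ = a ^ 3 * b ^ 3 := mul_pow _ _ _
      _ ≤ _ := Nat.mul_le_mul ih₁ ih₂

theorem cpxW_cpx {n : ℕ} (hn : 0 < n) : CpxW n (cpx n) :=
  Nat.sInf_mem (s := {k | CpxW n k}) ⟨n, CpxW.self hn⟩

theorem CpxW.cpx_le {n k : ℕ} (h : CpxW n k) : cpx n ≤ k := Nat.sInf_le h

theorem cpx_pos {n : ℕ} (hn : 0 < n) : 0 < cpx n := (cpxW_cpx hn).pos.2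

theorem cpx_add_le {a b : ℕ} (ha : 0 < a) (hb : 0 < b) : cpx (a + b) ≤ cpx a + cpx b :=
  ((cpxW_cpx ha).add (cpxW_cpx hb)).cpx_le

theorem cpx_mul_le {a b : ℕ} (ha : 0 < a) (hb : 0 < b) : cpx (a * b) ≤ cpx a + cpx b :=
  ((cpxW_cpx ha).mul (cpxW_cpx hb)).cpx_le

theorem cpxW_three : CpxW 3 3 := (CpxW.one.add .one).add .one

theorem cpx_mul_three_pow_le {n : ℕ} (hn : 0 < n) (j : ℕ) : cpx (n * 3 ^ j) ≤ cpx n + 3 * j := by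
  induction j with
  | zero => simp
  | succ j ih =>
    have h₁ : cpx (n * 3 ^ j * 3) ≤ cpx (n * 3 ^ j) + cpx 3 := cpx_mul_le (by positivity) (by norm_num)
    have h₂ := cpxW_three.cpx_le
    rw [pow_succ, ← mul_assoc]
    omega

theorem three_le_cpx_three : 3 ≤ cpx 3 := by
  have h := (cpxW_cpx (n := 3) (by norm_num)).cube_le
  exact (Nat.pow_le_pow_iff_right (by norm_num : 1 < 3)).1 h

/-- A positive integer other than `1` has a most efficient representation as a sum or as a
nontrivial product. -/
theorem cpx_cases {n : ℕ} (hn : 0 < n) :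
    n = 1 ∨
    (∃ a b, 0 < b ∧ b ≤ a ∧ n = a + b ∧ cpx n = cpx a + cpx b) ∨
    (∃ a b, 1 < a ∧ 1 < b ∧ n = a * b ∧ cpx n = cpx a + cpx b) := by
  have h := cpxW_cpx hn
  generalize hk : cpx n = k at h
  cases h with
  | one => exact .inl rfl
  | @add a b p q h₁ h₂ =>
    refine .inr (.inl ?_)
    have := h₁.cpx_le
    have := h₂.cpx_le
    have := cpx_add_le h₁.pos.1 h₂.pos.1
    obtain h | h := le_total b a
    · exact ⟨a, b, h₂.pos.1, h, rfl, by omega⟩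
    · exact ⟨b, a, h₁.pos.1, h, add_comm _ _, by omega⟩
  | @mul a b p q h₁ h₂ =>
    refine .inr (.inr ?_)
    have := h₁.cpx_le
    have := h₂.cpx_le
    have := h₁.pos
    have := h₂.pos
    have := cpx_mul_le h₁.pos.1 h₂.pos.1
    have ha : a ≠ 1 := by rintro rfl; rw [one_mul] at hk; omega
    have hb : b ≠ 1 := by rintro rfl; rw [mul_one] at hk; omega
    exact ⟨a, b, by omega, by omega, rfl, by omega⟩

/-! ### Defects -/

theorem three_mul_logb_le {n k : ℕ} (hn : 0 < n) (h : n ^ 3 ≤ 3 ^ k) :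
    3 * Real.logb 3 n ≤ k := by
  have h' : ((n : ℝ) ^ 3) ≤ 3 ^ k := by exact_mod_cast h
  have h₂ := Real.logb_le_logb_of_le (b := 3) (by norm_num) (by positivity) h'
  rw [Real.logb_pow, Real.logb_pow, Real.logb_self_eq_one (by norm_num)] at h₂
  simpa using h₂

theorem defect_nonneg {n : ℕ} (hn : 0 < n) : 0 ≤ defect n := by
  have := three_mul_logb_le hn (cpxW_cpx hn).cube_le
  unfold defect
  linarith

theorem defect_mul {a b : ℕ} (ha : 0 < a) (hb : 0 < b) (h : cpx (a * b) = cpx a + cpx b) :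
    defect (a * b) = defect a + defect b := by
  unfold defect
  rw [h, Nat.cast_mul, Real.logb_mul (by positivity) (by positivity)]
  push_cast
  ring

theorem logb_three_add_le {x c : ℝ} (hx : 0 < x) (hc : 0 ≤ c) :
    Real.logb 3 (x + c) ≤ Real.logb 3 x + c / x := by
  have h : x + c = x * (1 + c / x) := by field_simp
  have hcx : 0 ≤ c / x := by positivity
  rw [h, Real.logb_mul hx.ne' (by positivity)]
  gcongr
  have h3 : 1 ≤ Real.log 3 := by
    rw [Real.le_log_iff_exp_le (by norm_num)]
    linarith [Real.exp_one_lt_d9]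
  rw [Real.logb, div_le_iff₀ (by linarith)]
  have := Real.log_le_sub_one_of_pos (show 0 < 1 + c / x by positivity)
  nlinarith

/-- In a most efficient representation `a + b` of a number of defect less than `s`, the smaller
summand is bounded, and the larger is either bounded or of substantially smaller defect. -/
theorem exists_bound_of_defect_add_lt (s : ℝ) :
    ∃ M B : ℕ, ∀ a b : ℕ, 0 < b → b ≤ a → cpx (a + b) = cpx a + cpx b → defect (a + b) < s →
      b ≤ B ∧ (a ≤ M ∨ defect a < s - 1 / 2) := by
  refine ⟨6 * 3 ^ ⌈s + 3⌉₊, 3 ^ ⌈s + 3⌉₊, fun a b hb hba hc hd => ?_⟩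
  have ha : 0 < a := by omega
  have haR : (0 : ℝ) < a := by exact_mod_cast ha
  have hbaR : (b : ℝ) ≤ a := by exact_mod_cast hba
  have hlog := logb_three_add_le haR (Nat.cast_nonneg b)
  have hda := defect_nonneg ha
  have heq : defect (a + b) = cpx a + cpx b - 3 * Real.logb 3 (a + b) := by
    rw [defect, hc]; push_cast; ring
  have hbB : b ≤ 3 ^ ⌈s + 3⌉₊ := by
    have h₁ : (b : ℝ) / a ≤ 1 := (div_le_one haR).2 hbaR
    have h₂ : (cpx b : ℝ) ≤ ⌈s + 3⌉₊ := by
      refine le_trans ?_ (Nat.le_ceil _)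
      unfold defect at hda
      linarith
    calc b ≤ b ^ 3 := Nat.le_self_pow (by norm_num) b
      _ ≤ 3 ^ cpx b := (cpxW_cpx hb).cube_le
      _ ≤ _ := Nat.pow_le_pow_right (by norm_num) (by exact_mod_cast h₂)
  refine ⟨hbB, or_iff_not_imp_left.2 fun hM => ?_⟩
  have h₁ : (b : ℝ) / a ≤ 1 / 6 := by
    rw [div_le_iff₀ haR]
    have : (6 * b : ℝ) ≤ a := by exact_mod_cast (show 6 * b ≤ a by omega)
    linarith
  have h₂ : (1 : ℝ) ≤ cpx b := by exact_mod_cast cpx_pos hb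
  rw [heq] at hd
  unfold defect
  linarith

/-! ### Leaders -/

theorem exists_leader {a : ℕ} (ha : 0 < a) :
    ∃ b j, IsLeader b ∧ a = b * 3 ^ j ∧ cpx a = cpx b + 3 * j := by
  induction a using Nat.strong_induction_on with
  | _ a ih =>
    by_cases hl : IsLeader a
    · exact ⟨a, 0, hl, by simp, by simp⟩
    · have h : 3 ∣ a ∧ cpx (a / 3) + 3 ≤ cpx a := by
        simpa [IsLeader, ha] using hl
      obtain ⟨⟨c, rfl⟩, h⟩ := h
      rw [Nat.mul_div_cancel_left c (by norm_num)] at h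
      obtain ⟨b, j, hb, rfl, hj⟩ := ih c (by omega) (by omega)
      refine ⟨b, j + 1, hb, by ring, ?_⟩
      have := cpx_mul_three_pow_le hb.1 (j + 1)
      rw [show 3 * (b * 3 ^ j) = b * 3 ^ (j + 1) by ring] at h ⊢
      omega

theorem IsLeader.of_mul_left {a b : ℕ} (h : IsLeader (a * b)) (hc : cpx (a * b) = cpx a + cpx b) :
    IsLeader a := by
  have hb : 0 < b := Nat.pos_of_mul_pos_left h.1
  have ha : 0 < a := Nat.pos_of_mul_pos_right h.1
  refine ⟨ha, ?_⟩
  rintro ⟨c, rfl⟩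
  have h₁ := h.2 ⟨c * b, by ring⟩
  rw [hc, mul_assoc, Nat.mul_div_cancel_left _ (by norm_num)] at h₁
  rw [Nat.mul_div_cancel_left _ (by norm_num)]
  have := cpx_mul_le (a := c) (b := b) (by omega) hb
  omega

theorem IsLeader.of_mul_right {a b : ℕ} (h : IsLeader (a * b))
    (hc : cpx (a * b) = cpx a + cpx b) : IsLeader b := by
  rw [mul_comm] at h hc
  exact h.of_mul_left (by omega)

theorem IsLeader.ne_three_of_mul {a b : ℕ} (h : IsLeader (a * b))
    (hc : cpx (a * b) = cpx a + cpx b) : a ≠ 3 := by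
  rintro rfl
  have h₁ := h.2 ⟨b, rfl⟩
  rw [hc, Nat.mul_div_cancel_left _ (by norm_num)] at h₁
  have := three_le_cpx_three
  omega

theorem IsLeader.defect_pos {n : ℕ} (h : IsLeader n) (h3 : n ≠ 3) : 0 < defect n := by
  refine lt_of_le_of_ne (defect_nonneg h.1) fun h0 => h3 ?_
  have hn : (0 : ℝ) < n := by exact_mod_cast h.1
  have h₁ : (n : ℝ) ^ 3 = 3 ^ cpx n := by
    apply Real.logb_injOn_pos (b := 3) (by norm_num) (Set.mem_Ioi.2 (by positivity))
      (Set.mem_Ioi.2 (by positivity))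
    rw [Real.logb_pow, Real.logb_pow, Real.logb_self_eq_one (by norm_num)]
    unfold defect at h0
    push_cast
    linarith
  have h₂ : n ^ 3 = 3 ^ cpx n := by exact_mod_cast h₁
  obtain ⟨j, -, rfl⟩ := (Nat.dvd_prime_pow Nat.prime_three).1
    (h₂ ▸ dvd_pow_self n (by norm_num) : n ∣ 3 ^ cpx n)
  rw [← pow_mul] at h₂
  have hj : j * 3 = cpx (3 ^ j) := Nat.pow_right_injective (by norm_num : 2 ≤ 3) h₂
  obtain _ | _ | j := j
  · have := cpx_pos (n := 3 ^ 0) (by norm_num)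
    omega
  · norm_num
  · exfalso
    have h₃ := h.2 ⟨3 ^ (j + 1), by ring⟩
    rw [pow_succ, Nat.mul_div_cancel _ (by norm_num), ← pow_succ, ← hj] at h₃
    have h₄ := cpx_mul_three_pow_le (n := 3) (by norm_num) j
    have := cpxW_three.cpx_le
    rw [← pow_succ'] at h₄
    omega

theorem defect_one : defect 1 = 1 := by
  have h₁ := CpxW.one.cpx_le
  have h₂ := cpx_pos one_pos
  have : cpx 1 = 1 := by omega
  simp [defect, this]

/-- The defects of leaders other than `3` are bounded away from zero. -/
theorem exists_leader_defect_ge :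
    ∃ η : ℝ, 0 < η ∧ η ≤ 1 / 2 ∧ ∀ n, IsLeader n → n ≠ 3 → η ≤ defect n := by
  obtain ⟨M, B, hMB⟩ := exists_bound_of_defect_add_lt (1 / 2)
  obtain ⟨η₀, hη₀, hmin⟩ : ∃ η : ℝ, 0 < η ∧ ∀ n ≤ M + B, IsLeader n → n ≠ 3 → η ≤ defect n := by
    have hfin : {n | n ≤ M + B ∧ IsLeader n ∧ n ≠ 3}.Finite :=
      (Set.finite_Iic (M + B)).subset fun n hn => hn.1
    obtain hne | hne := {n | n ≤ M + B ∧ IsLeader n ∧ n ≠ 3}.eq_empty_or_nonempty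
    · refine ⟨1, one_pos, fun n h₁ h₂ h₃ => ?_⟩
      exact absurd (show n ∈ {n | n ≤ M + B ∧ IsLeader n ∧ n ≠ 3} from ⟨h₁, h₂, h₃⟩) (by simp [hne])
    · obtain ⟨m, hm, hle⟩ := hfin.exists_minimalFor defect _ hne
      refine ⟨defect m, hm.2.1.defect_pos hm.2.2, fun n h₁ h₂ h₃ => ?_⟩
      obtain h | h := le_total (defect m) (defect n)
      · exact h
      · exact hle ⟨h₁, h₂, h₃⟩ h
  refine ⟨min η₀ (1 / 2), by positivity, min_le_right _ _, fun n => ?_⟩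
  induction n using Nat.strong_induction_on with
  | _ n ih =>
    intro hl h3
    obtain rfl | ⟨a, b, hb, hba, rfl, hc⟩ | ⟨a, b, ha, hb, rfl, hc⟩ := cpx_cases hl.1
    · rw [defect_one]
      exact (min_le_right _ _).trans (by norm_num)
    · by_contra! hlt
      obtain ⟨hbB, haM⟩ := hMB a b hb hba hc (hlt.trans_le (min_le_right _ _))
      have haM : a ≤ M := haM.resolve_right (by
        have := defect_nonneg (n := a) (by omega)
        linarith)
      exact absurd (hmin _ (by omega) hl h3) (not_le.2 (hlt.trans_le (min_le_left _ _)))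
    · rw [defect_mul (by omega) (by omega) hc]
      have := ih a (by nlinarith) (hl.of_mul_left hc) (hl.ne_three_of_mul hc)
      linarith [defect_nonneg (n := b) (by omega)]

/-! ### Formal constructions of low-defect pairs -/

/-- Formal constructions of low-defect pairs. -/
inductive LDTree : Type
  | const (k C : ℕ) : LDTree
  | mul (T U : LDTree) : LDTree
  | step (T : LDTree) (c D : ℕ) : LDTree

namespace LDTree

/-- The side conditions making a formal construction valid. -/
def WF : LDTree → Prop
  | const k C => 0 < k ∧ cpx k ≤ C
  | mul T U => T.WF ∧ U.WF
  | step T c D => T.WF ∧ 0 < c ∧ cpx c ≤ D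

/-- The degree. -/
def deg : LDTree → ℕ
  | const _ _ => 0
  | mul T U => T.deg + U.deg
  | step T _ _ => T.deg + 1

/-- The base complexity. -/
def base : LDTree → ℕ
  | const _ C => C
  | mul T U => T.base + U.base
  | step T _ D => T.base + D

/-- The leading coefficient. -/
def lead : LDTree → ℕ
  | const k _ => k
  | mul T U => T.lead * U.lead
  | step T _ _ => T.lead

/-- The low-defect polynomial. -/
noncomputable def poly : LDTree → MvPolynomial ℕ ℤ
  | const k _ => MvPolynomial.C (k : ℤ)
  | mul T U => T.poly * MvPolynomial.rename (· + T.deg) U.poly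
  | step T c _ => T.poly * MvPolynomial.X T.deg + MvPolynomial.C (c : ℤ)

/-- `T.Rep n m`: the value `n` is taken by the polynomial at some powers of `3`, with total
cost `m`. -/
def Rep : LDTree → ℕ → ℕ → Prop
  | const k C, n, m => n = k ∧ m = C
  | mul T U, n, m => ∃ n₁ m₁ n₂ m₂, T.Rep n₁ m₁ ∧ U.Rep n₂ m₂ ∧ n = n₁ * n₂ ∧ m = m₁ + m₂
  | step T c D, n, m => ∃ n' m' j, T.Rep n' m' ∧ n = n' * 3 ^ j + c ∧ m = m' + 3 * j + D

/-- The defect of the pair. -/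
noncomputable def dft (T : LDTree) : ℝ := T.base - 3 * Real.logb 3 T.lead

theorem lead_pos {T : LDTree} (h : T.WF) : 0 < T.lead := by
  induction T with
  | const k C => exact h.1
  | mul T U ihT ihU => exact Nat.mul_pos (ihT h.1) (ihU h.2)
  | step T c D ih => exact ih h.1

theorem cpx_lead_add_deg_le {T : LDTree} (h : T.WF) : cpx T.lead + T.deg ≤ T.base := by
  induction T with
  | const k C => exact h.2
  | mul T U ihT ihU =>
    have := cpx_mul_le (lead_pos h.1) (lead_pos h.2)
    have := ihT h.1
    have := ihU h.2
    simp only [lead, deg, base]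
    omega
  | step T c D ih =>
    have := ih h.1
    have := cpx_pos h.2.1
    have := h.2.2
    simp only [lead, deg, base]
    omega

theorem deg_le_dft {T : LDTree} (h : T.WF) : (T.deg : ℝ) ≤ T.dft := by
  have h₁ : ((cpx T.lead + T.deg : ℕ) : ℝ) ≤ T.base := by exact_mod_cast cpx_lead_add_deg_le h
  have h₂ := defect_nonneg (lead_pos h)
  unfold defect at h₂
  unfold dft
  push_cast at h₁
  linarith

theorem dft_mul {T U : LDTree} (hT : T.WF) (hU : U.WF) : (mul T U).dft = T.dft + U.dft := by
  have h₁ : (T.lead : ℝ) ≠ 0 := by exact_mod_cast (lead_pos hT).ne'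
  have h₂ : (U.lead : ℝ) ≠ 0 := by exact_mod_cast (lead_pos hU).ne'
  simp only [dft, base, lead]
  push_cast
  rw [Real.logb_mul h₁ h₂]
  ring

theorem dft_step (T : LDTree) (c D : ℕ) : (step T c D).dft = T.dft + D := by
  simp only [dft, base, lead]
  push_cast
  ring

theorem Rep.pos_and_cpx_le {T : LDTree} (h : T.WF) {n m : ℕ} (hr : T.Rep n m) :
    0 < n ∧ cpx n ≤ m := by
  induction T generalizing n m with
  | const k C =>
    obtain ⟨rfl, rfl⟩ := hr
    exact h
  | mul T U ihT ihU =>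
    obtain ⟨n₁, m₁, n₂, m₂, h₁, h₂, rfl, rfl⟩ := hr
    have i₁ := ihT h.1 h₁
    have i₂ := ihU h.2 h₂
    exact ⟨Nat.mul_pos i₁.1 i₂.1, (cpx_mul_le i₁.1 i₂.1).trans (by omega)⟩
  | step T c D ih =>
    obtain ⟨n', m', j, h', rfl, rfl⟩ := hr
    have i := ih h.1 h'
    have h₁ := cpx_mul_three_pow_le i.1 j
    have h₂ : 0 < n' * 3 ^ j := Nat.mul_pos i.1 (by positivity)
    have h₃ := cpx_add_le h₂ h.2.1
    have := h.2.2
    exact ⟨by omega, by omega⟩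

theorem Rep.three_pow_le {T : LDTree} {n m : ℕ} (h : T.WF) (hr : T.Rep n m) :
    3 ^ m ≤ 3 ^ T.base * n ^ 3 := by
  induction T generalizing n m with
  | const k C =>
    obtain ⟨rfl, rfl⟩ := hr
    exact Nat.le_mul_of_pos_right _ (pow_pos h.1 3)
  | mul T U ihT ihU =>
    obtain ⟨n₁, m₁, n₂, m₂, h₁, h₂, rfl, rfl⟩ := hr
    calc 3 ^ (m₁ + m₂) = 3 ^ m₁ * 3 ^ m₂ := pow_add _ _ _
      _ ≤ (3 ^ T.base * n₁ ^ 3) * (3 ^ U.base * n₂ ^ 3) :=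
        Nat.mul_le_mul (ihT h.1 h₁) (ihU h.2 h₂)
      _ = _ := by simp only [base]; ring
  | step T c D ih =>
    obtain ⟨n', m', j, h', rfl, rfl⟩ := hr
    calc 3 ^ (m' + 3 * j + D) = 3 ^ m' * (3 ^ (3 * j) * 3 ^ D) := by ring
      _ ≤ (3 ^ T.base * n' ^ 3) * (3 ^ (3 * j) * 3 ^ D) := Nat.mul_le_mul_right _ (ih h.1 h')
      _ = 3 ^ (T.base + D) * (n' * 3 ^ j) ^ 3 := by ring
      _ ≤ _ := Nat.mul_le_mul_left _ (Nat.pow_le_pow_left (Nat.le_add_right _ _) 3)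

/-! ### Covering leaders -/

/-- Leaders whose defect is bounded are covered by finitely many constructions. -/
theorem exists_finite_covering (s : ℝ) :
    ∃ F : Set LDTree, F.Finite ∧ (∀ T ∈ F, T.WF) ∧
      ∀ n, IsLeader n → defect n < s → ∃ T ∈ F, T.Rep n (cpx n) := by
  obtain ⟨η, hη, hη', hmin⟩ := exists_leader_defect_ge
  suffices H : ∀ N : ℕ, ∃ F : Set LDTree, F.Finite ∧ (∀ T ∈ F, T.WF) ∧
      ∀ n, IsLeader n → defect n < N * η → ∃ T ∈ F, T.Rep n (cpx n) by
    obtain ⟨N, hN⟩ := exists_nat_ge (s / η)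
    obtain ⟨F, h₁, h₂, h₃⟩ := H N
    exact ⟨F, h₁, h₂, fun n hl hd => h₃ n hl (hd.trans_le ((div_le_iff₀ hη).1 hN))⟩
  intro N
  induction N with
  | zero =>
    refine ⟨∅, Set.finite_empty, by simp, fun n hl hd => ?_⟩
    have := defect_nonneg hl.1
    norm_num at hd
    linarith
  | succ N ih =>
    obtain ⟨F, hF, hwf, hcov⟩ := ih
    obtain ⟨M, B, hMB⟩ := exists_bound_of_defect_add_lt ((N + 1 : ℕ) * η)
    have hconst {n : ℕ} (hn : 0 < n) (hle : n ≤ M + B + 1) :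
        const n (cpx n) ∈ (fun n => const n (cpx n)) '' Set.Icc 1 (M + B + 1) := ⟨n, ⟨hn, hle⟩, rfl⟩
    refine ⟨(fun n => const n (cpx n)) '' Set.Icc 1 (M + B + 1) ∪ Set.image2 mul F F ∪
      Set.image2 (fun T b => step T b (cpx b)) F (Set.Icc 1 B),
      (((Set.finite_Icc _ _).image _).union (hF.image2 _ hF)).union
        (hF.image2 _ (Set.finite_Icc _ _)), ?_, fun n hl hd => ?_⟩
    · rintro _ ((⟨n, hn, rfl⟩ | ⟨T, hT, U, hU, rfl⟩) | ⟨T, hT, b, hb, rfl⟩)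
      · exact ⟨hn.1, le_rfl⟩
      · exact ⟨hwf T hT, hwf U hU⟩
      · exact ⟨hwf T hT, hb.1, le_rfl⟩
    obtain rfl | ⟨a, b, hb, hba, rfl, hc⟩ | ⟨a, b, ha, hb, rfl, hc⟩ := cpx_cases hl.1
    · exact ⟨_, .inl (.inl (hconst one_pos (by omega))), rfl, rfl⟩
    · obtain ⟨hbB, haM | had⟩ := hMB a b hb hba hc hd
      · exact ⟨_, .inl (.inl (hconst hl.1 (by omega))), rfl, rfl⟩
      · obtain ⟨a', j, hl', rfl, hca⟩ := exists_leader (a := a) (by omega)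
        have hpos : (a' : ℝ) ≠ 0 := by exact_mod_cast hl'.1.ne'
        have hda : defect a' = defect (a' * 3 ^ j) := by
          unfold defect
          rw [hca]
          push_cast
          rw [Real.logb_mul hpos (by positivity), Real.logb_pow,
            Real.logb_self_eq_one (by norm_num)]
          ring
        obtain ⟨T, hT, hr⟩ := hcov a' hl' (by push_cast at had; linarith)
        exact ⟨_, .inr ⟨T, hT, b, ⟨hb, hbB⟩, rfl⟩, a', _, j, hr, rfl, by omega⟩
    · rw [defect_mul (by omega) (by omega) hc] at hd
      push_cast at hd
      have hla := hl.of_mul_left hc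
      have hlb := hl.of_mul_right hc
      have hna := hmin a hla (hl.ne_three_of_mul hc)
      have hnb := hmin b hlb (by
        rw [mul_comm] at hl hc
        exact hl.ne_three_of_mul (by omega))
      obtain ⟨T, hT, hrT⟩ := hcov a hla (by linarith)
      obtain ⟨U, hU, hrU⟩ := hcov b hlb (by linarith)
      exact ⟨_, .inl (.inr ⟨T, hT, U, hU, rfl⟩), a, _, b, _, hrT, hrU, rfl, hc⟩

/-! ### Truncation -/

/-- Apart from values covered by finitely many constructions of smaller degree, the values of a
construction have defect close to its limiting defect. -/
theorem exists_finite_smaller_degree {T : LDTree} (h : T.WF) {ε : ℝ} (hε : 0 < ε) :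
    ∃ F : Set LDTree, F.Finite ∧ (∀ U ∈ F, U.WF ∧ U.deg < T.deg) ∧
      ∀ n m, T.Rep n m → T.dft - ε < m - 3 * Real.logb 3 n ∨ ∃ U ∈ F, U.Rep n m := by
  induction T generalizing ε with
  | const k C =>
    refine ⟨∅, Set.finite_empty, by simp, ?_⟩
    rintro n m ⟨rfl, rfl⟩
    left
    simp only [dft, base, lead]
    linarith
  | mul T U ihT ihU =>
    obtain ⟨F, hF, hF', hFc⟩ := ihT h.1 (half_pos hε)
    obtain ⟨G, hG, hG', hGc⟩ := ihU h.2 (half_pos hε)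
    refine ⟨(mul · U) '' F ∪ mul T '' G, (hF.image _).union (hG.image _), ?_, ?_⟩
    · rintro _ (⟨V, hV, rfl⟩ | ⟨V, hV, rfl⟩)
      · exact ⟨⟨(hF' V hV).1, h.2⟩, Nat.add_lt_add_right (hF' V hV).2 _⟩
      · exact ⟨⟨h.1, (hG' V hV).1⟩, Nat.add_lt_add_left (hG' V hV).2 _⟩
    · rintro _ _ ⟨n₁, m₁, n₂, m₂, h₁, h₂, rfl, rfl⟩
      obtain i₁ | ⟨V, hV, hr⟩ := hFc _ _ h₁
      · obtain i₂ | ⟨V, hV, hr⟩ := hGc _ _ h₂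
        · left
          have p₁ : (n₁ : ℝ) ≠ 0 := by exact_mod_cast (h₁.pos_and_cpx_le h.1).1.ne'
          have p₂ : (n₂ : ℝ) ≠ 0 := by exact_mod_cast (h₂.pos_and_cpx_le h.2).1.ne'
          rw [dft_mul h.1 h.2]
          push_cast
          rw [Real.logb_mul p₁ p₂]
          linarith
        · exact .inr ⟨_, .inr ⟨V, hV, rfl⟩, n₁, m₁, n₂, m₂, h₁, hr, rfl, rfl⟩
      · exact .inr ⟨_, .inl ⟨V, hV, rfl⟩, n₁, m₁, n₂, m₂, hr, h₂, rfl, rfl⟩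
  | step T c D ih =>
    obtain ⟨F, hF, hF', hFc⟩ := ih h.1 (half_pos hε)
    obtain ⟨M, hM⟩ := exists_nat_ge (6 * c / ε)
    have hwf' : (step T c D).WF := h
    let K := 3 ^ (T.base + D) * (M + c) ^ 3
    refine ⟨(step · c D) '' F ∪
      {U ∈ Set.image2 const (Set.Iic (M + c)) (Set.Iic K) | U.WF},
      (hF.image _).union ((((Set.finite_Iic _).image2 _ (Set.finite_Iic _))).subset
        (Set.sep_subset _ _)), ?_, ?_⟩
    · rintro _ (⟨V, hV, rfl⟩ | ⟨⟨n, hn, m, hm, rfl⟩, hU⟩)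
      · exact ⟨⟨(hF' V hV).1, h.2⟩, Nat.add_lt_add_right (hF' V hV).2 _⟩
      · exact ⟨hU, Nat.succ_pos _⟩
    · intro n m hr
      have hr₀ := hr
      obtain ⟨n', m', j, h', rfl, rfl⟩ := hr
      obtain i | ⟨V, hV, hr⟩ := hFc _ _ h'
      · obtain hlt | hge := lt_or_ge (n' * 3 ^ j) M
        · right
          refine ⟨const (n' * 3 ^ j + c) (m' + 3 * j + D), .inr ⟨⟨_, ?_, _, ?_, rfl⟩, ?_⟩, rfl, rfl⟩
          · exact Set.mem_Iic.2 (by omega)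
          · refine Set.mem_Iic.2 ((Nat.lt_pow_self (by norm_num : 1 < 3)).le.trans
              ((hr₀.three_pow_le hwf').trans ?_))
            exact Nat.mul_le_mul_left _ (Nat.pow_le_pow_left (by omega) 3)
          · exact hr₀.pos_and_cpx_le hwf'
        · left
          have p : (0 : ℝ) < n' := by exact_mod_cast (h'.pos_and_cpx_le h.1).1
          have hx : (0 : ℝ) < n' * 3 ^ j := by positivity
          have hlog := logb_three_add_le hx (Nat.cast_nonneg c)
          rw [Real.logb_mul p.ne' (by positivity), Real.logb_pow,
            Real.logb_self_eq_one (by norm_num)] at hlog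
          have hge' : (M : ℝ) ≤ n' * 3 ^ j := by exact_mod_cast hge
          have hsmall : (c : ℝ) / (n' * 3 ^ j) ≤ ε / 6 := by
            rw [div_le_iff₀ hx]
            rw [div_le_iff₀ hε] at hM
            nlinarith
          rw [dft_step]
          push_cast
          linarith
      · exact .inr ⟨_, .inl ⟨V, hV, rfl⟩, n', m', j, hr, rfl, rfl⟩

/-- The values of defect less than `s` of a construction are covered by finitely many constructions
of defect at most `s`. -/
theorem exists_finite_truncation (s : ℝ) {T : LDTree} (h : T.WF) :
    ∃ F : Set LDTree, F.Finite ∧ (∀ U ∈ F, U.WF ∧ U.dft ≤ s ∧ (U.deg = 0 → U.dft < s)) ∧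
      ∀ n m : ℕ, T.Rep n m → m - 3 * Real.logb 3 n < s → ∃ U ∈ F, U.Rep n m := by
  induction hd : T.deg using Nat.strong_induction_on generalizing T with
  | _ d ih =>
    subst hd
    by_cases hT : T.dft ≤ s ∧ (T.deg = 0 → T.dft < s)
    · refine ⟨{T}, Set.finite_singleton T, ?_, fun n m hr _ => ⟨T, rfl, hr⟩⟩
      rintro _ rfl
      exact ⟨h, hT⟩
    obtain hlt | hle := lt_or_ge s T.dft
    · obtain ⟨F, hF, hF', hFc⟩ := exists_finite_smaller_degree h (sub_pos.2 hlt)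
      have key : ∀ U : F, ∃ G : Set LDTree, G.Finite ∧
          (∀ V ∈ G, V.WF ∧ V.dft ≤ s ∧ (V.deg = 0 → V.dft < s)) ∧
          ∀ n m : ℕ, U.1.Rep n m → m - 3 * Real.logb 3 n < s → ∃ V ∈ G, V.Rep n m :=
        fun U => ih _ (hF' U U.2).2 (hF' U U.2).1 rfl
      choose G hG hG' hGc using key
      have : Finite F := hF
      refine ⟨⋃ U, G U, Set.finite_iUnion hG, ?_, fun n m hr hlt' => ?_⟩
      · intro V hV
        obtain ⟨U, hU⟩ := Set.mem_iUnion.1 hV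
        exact hG' U V hU
      · obtain i | ⟨U, hU, hr'⟩ := hFc n m hr
        · linarith
        · obtain ⟨V, hV, hr''⟩ := hGc ⟨U, hU⟩ n m hr' hlt'
          exact ⟨V, Set.mem_iUnion.2 ⟨_, hV⟩, hr''⟩
    · have h₀ : T.deg = 0 ∧ s ≤ T.dft := by simpa [hle] using hT
      refine ⟨∅, Set.finite_empty, by simp, fun n m hr hlt => ?_⟩
      obtain ⟨F, -, hF', hFc⟩ := exists_finite_smaller_degree h (sub_pos.2 hlt)
      obtain i | ⟨U, hU, -⟩ := hFc n m hr
      · linarith [h₀.2]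
      · have := (hF' U hU).2
        omega

/-! ### The associated polynomials -/

theorem ldp {T : LDTree} (h : T.WF) : LDP T.deg T.poly T.base := by
  induction T with
  | const k C => exact .const k C h.1 h.2
  | mul T U ihT ihU => exact .mul (ihT h.1) (ihU h.2)
  | step T c D ih => exact .step c D h.2.1 h.2.2 (ih h.1)

theorem Rep.exists_eval {T : LDTree} {n m : ℕ} (hr : T.Rep n m) :
    ∃ k : ℕ → ℕ, (∀ x : ℕ → ℤ, (∀ i < T.deg, x i = 3 ^ k i) → MvPolynomial.eval x T.poly = n) ∧
      m = T.base + 3 * ∑ i ∈ Finset.range T.deg, k i := by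
  induction T generalizing n m with
  | const k C =>
    obtain ⟨rfl, rfl⟩ := hr
    exact ⟨0, by simp [poly], by simp [base]⟩
  | mul T U ihT ihU =>
    obtain ⟨n₁, m₁, n₂, m₂, h₁, h₂, rfl, rfl⟩ := hr
    obtain ⟨k₁, e₁, rfl⟩ := ihT h₁
    obtain ⟨k₂, e₂, rfl⟩ := ihU h₂
    refine ⟨fun i => if i < T.deg then k₁ i else k₂ (i - T.deg), fun x hx => ?_, ?_⟩
    · simp only [deg] at hx
      rw [poly, map_mul, MvPolynomial.eval_rename, e₁, e₂, Nat.cast_mul]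
      · intro i hi
        simpa using hx (i + T.deg) (by omega)
      · intro i hi
        simpa [hi] using hx i (by omega)
    · have hs : ∑ i ∈ Finset.range T.deg, (if i < T.deg then k₁ i else k₂ (i - T.deg)) =
          ∑ i ∈ Finset.range T.deg, k₁ i :=
        Finset.sum_congr rfl fun i hi => if_pos (Finset.mem_range.1 hi)
      simp only [deg, base, Finset.sum_range_add, hs]
      simp
      ring
  | step T c D ih =>
    obtain ⟨n', m', j, h', rfl, rfl⟩ := hr
    obtain ⟨k, e, rfl⟩ := ih h'
    refine ⟨fun i => if i < T.deg then k i else j, fun x hx => ?_, ?_⟩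
    · simp only [deg] at hx
      have hxr : x T.deg = 3 ^ j := by simpa using hx T.deg (by omega)
      simp only [poly, map_add, map_mul, MvPolynomial.eval_X, MvPolynomial.eval_C, hxr]
      rw [e]
      · push_cast
        ring
      · intro i hi
        simpa [hi] using hx i (by omega)
    · have hs : ∑ i ∈ Finset.range T.deg, (if i < T.deg then k i else j) =
          ∑ i ∈ Finset.range T.deg, k i :=
        Finset.sum_congr rfl fun i hi => if_pos (Finset.mem_range.1 hi)
      simp only [deg, base, Finset.sum_range_succ, hs]
      simp
      ring

theorem Rep.effRep {T : LDTree} {n : ℕ} (hr : T.Rep n (cpx n)) :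
    EffRep T.deg T.poly T.base n := by
  obtain ⟨k, he, hm⟩ := hr.exists_eval
  exact ⟨k, (he _ fun i hi => if_pos hi).symm, hm⟩

end LDTree

namespace MvPolynomial

variable {σ R : Type*} [CommSemiring R] {f g : MvPolynomial σ R} {A B : σ →₀ ℕ}

theorem le_add_of_mem_support_mul (hf : ∀ m ∈ f.support, m ≤ A) (hg : ∀ m ∈ g.support, m ≤ B) :
    ∀ m ∈ (f * g).support, m ≤ A + B := by
  classical
  intro m hm
  obtain ⟨a, ha, b, hb, rfl⟩ := Finset.mem_add.1 (support_mul f g hm)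
  exact add_le_add (hf a ha) (hg b hb)

theorem coeff_add_mul_of_support_le (hf : ∀ m ∈ f.support, m ≤ A) (hg : ∀ m ∈ g.support, m ≤ B) :
    coeff (A + B) (f * g) = coeff A f * coeff B g := by
  classical
  rw [coeff_mul]
  refine Finset.sum_eq_single (A, B) ?_ (by simp)
  rintro ⟨a, b⟩ hab hne
  rw [Finset.HasAntidiagonal.mem_antidiagonal] at hab
  simp only at hab
  by_contra h
  have ha : a ≤ A := hf a (mem_support_iff.2 (left_ne_zero_of_mul h))
  have hb : b ≤ B := hg b (mem_support_iff.2 (right_ne_zero_of_mul h))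
  refine hne ?_
  have h₁ : a = A := by
    refine le_antisymm ha fun i => ?_
    have h₂ := DFunLike.congr_fun hab i
    have h₃ := hb i
    simp only [Finsupp.add_apply] at h₂
    omega
  subst h₁
  rw [add_left_cancel hab]

end MvPolynomial

/-- The exponent vector of `x₀ ⋯ x_{r-1}`. -/
noncomputable def topExp (r : ℕ) : ℕ →₀ ℕ := ∑ i ∈ Finset.range r, Finsupp.single i 1

theorem topExp_apply (r j : ℕ) : topExp r j = if j < r then 1 else 0 := by
  simp [topExp, Finsupp.finsetSum_apply, Finsupp.single_apply]

theorem topExp_succ (r : ℕ) : topExp (r + 1) = topExp r + Finsupp.single r 1 :=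
  Finset.sum_range_succ _ _

theorem topExp_add (r₁ r₂ : ℕ) :
    topExp (r₁ + r₂) = topExp r₁ + Finsupp.mapDomain (· + r₁) (topExp r₂) := by
  rw [topExp, Finset.sum_range_add, topExp, topExp, Finsupp.mapDomain_finsetSum]
  simp [Finsupp.mapDomain_single, add_comm]

theorem le_topExp_of_mem_support_rename {f : MvPolynomial ℕ ℤ} {r₁ r₂ : ℕ}
    (hf : ∀ m ∈ f.support, m ≤ topExp r₂) :
    ∀ m ∈ (MvPolynomial.rename (· + r₁) f).support,
      m ≤ Finsupp.mapDomain (· + r₁) (topExp r₂) := by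
  classical
  intro m hm
  rw [MvPolynomial.support_rename_of_injective (add_left_injective r₁)] at hm
  obtain ⟨m', hm', rfl⟩ := Finset.mem_image.1 hm
  exact Finsupp.mapDomain_mono (hf m' hm')

theorem LDP.le_topExp {r : ℕ} {f : MvPolynomial ℕ ℤ} {C : ℕ} (h : LDP r f C) :
    ∀ m ∈ f.support, m ≤ topExp r := by
  classical
  induction h with
  | const k C hk hC =>
    intro m hm
    rw [MvPolynomial.mem_support_iff, MvPolynomial.coeff_C] at hm
    obtain rfl : 0 = m := by
      by_contra hne
      simp [hne] at hm
    exact zero_le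
  | @mul r₁ r₂ f₁ f₂ C₁ C₂ _ _ ih₁ ih₂ =>
    rw [topExp_add]
    exact MvPolynomial.le_add_of_mem_support_mul ih₁ (le_topExp_of_mem_support_rename ih₂)
  | @step r f C c D hc hD _ ih =>
    intro m hm
    obtain hm | hm := Finset.mem_union.1 (MvPolynomial.support_add hm)
    · rw [topExp_succ]
      exact MvPolynomial.le_add_of_mem_support_mul ih (by simp [MvPolynomial.support_X]) m hm
    · rw [MvPolynomial.mem_support_iff, MvPolynomial.coeff_C] at hm
      obtain rfl : 0 = m := by
        by_contra hne
        simp [hne] at hm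
      exact zero_le

theorem leadCoeff_mul {r₁ r₂ C₁ C₂ : ℕ} {f₁ f₂ : MvPolynomial ℕ ℤ} (h₁ : LDP r₁ f₁ C₁)
    (h₂ : LDP r₂ f₂ C₂) :
    leadCoeff (r₁ + r₂) (f₁ * MvPolynomial.rename (· + r₁) f₂) =
      leadCoeff r₁ f₁ * leadCoeff r₂ f₂ := by
  change MvPolynomial.coeff (topExp _) _ = MvPolynomial.coeff (topExp _) _ *
    MvPolynomial.coeff (topExp _) _
  rw [topExp_add, MvPolynomial.coeff_add_mul_of_support_le h₁.le_topExp
    (le_topExp_of_mem_support_rename h₂.le_topExp),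
    MvPolynomial.coeff_rename_mapDomain _ (add_left_injective r₁)]

theorem leadCoeff_step {r C : ℕ} {f : MvPolynomial ℕ ℤ} (h : LDP r f C) (c : ℤ) :
    leadCoeff (r + 1) (f * MvPolynomial.X r + MvPolynomial.C c) = leadCoeff r f := by
  classical
  change MvPolynomial.coeff (topExp _) _ = MvPolynomial.coeff (topExp _) _
  have hne : (0 : ℕ →₀ ℕ) ≠ topExp (r + 1) := fun h0 => by
    have := DFunLike.congr_fun h0 r
    simp [topExp_apply] at this
  rw [MvPolynomial.coeff_add, MvPolynomial.coeff_C, if_neg hne, add_zero, topExp_succ,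
    MvPolynomial.coeff_add_mul_of_support_le h.le_topExp (by simp [MvPolynomial.support_X])]
  simp

theorem leadCoeff_C (c : ℤ) : leadCoeff 0 (MvPolynomial.C c) = c := by
  rw [leadCoeff, Finset.range_zero, Finset.sum_empty, MvPolynomial.coeff_zero_C]

theorem LDP.leadCoeff_pos {r C : ℕ} {f : MvPolynomial ℕ ℤ} (h : LDP r f C) :
    0 < leadCoeff r f := by
  induction h with
  | const k C hk hC => rw [leadCoeff_C]; exact_mod_cast hk
  | mul h₁ h₂ ih₁ ih₂ => rw [leadCoeff_mul h₁ h₂]; exact mul_pos ih₁ ih₂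
  | step c D hc hD h ih => rwa [leadCoeff_step h]

theorem LDTree.leadCoeff_poly {T : LDTree} (h : T.WF) : leadCoeff T.deg T.poly = T.lead := by
  induction T with
  | const k C => exact leadCoeff_C k
  | mul T U ihT ihU =>
    rw [deg, poly, leadCoeff_mul (ldp h.1) (ldp h.2), ihT h.1, ihU h.2, lead, Nat.cast_mul]
  | step T c D ih => rw [deg, poly, leadCoeff_step (ldp h.1), ih h.1, lead]

theorem LDP.degree_le {r r' C C' : ℕ} {f : MvPolynomial ℕ ℤ} (h : LDP r f C) (h' : LDP r' f C') :
    r ≤ r' := by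
  by_contra! hlt
  have := h'.le_topExp (topExp r) (MvPolynomial.mem_support_iff.2 h.leadCoeff_pos.ne') r'
  simp [topExp_apply, hlt] at this

/-- For any real `s ≥ 0` there is a finite set `S` of low-defect
pairs such that every leader `n` with `δ(n) < s` is efficiently 3-represented by
some pair in `S`, and every `(f,C) ∈ S` satisfies `δ(f,C) ≤ s` (hence
`deg f ≤ ⌊s⌋`), strictly if `deg f = 0`. -/
theorem covering_truncated (s : ℝ) (hs : 0 ≤ s) :
    ∃ S : Set (MvPolynomial ℕ ℤ × ℕ), S.Finite ∧
      (∀ p ∈ S, ∃ r, LDP r p.1 p.2) ∧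
      (∀ n : ℕ, IsLeader n → defect n < s →
        ∃ p ∈ S, ∃ r, LDP r p.1 p.2 ∧ EffRep r p.1 p.2 n) ∧
      (∀ p ∈ S, ∀ r, LDP r p.1 p.2 →
        pairDft r p.1 p.2 ≤ s ∧ r ≤ Nat.floor s ∧
        (r = 0 → pairDft r p.1 p.2 < s)) := by
  obtain ⟨F, hF, hwf, hcov⟩ := LDTree.exists_finite_covering s
  have key : ∀ T : F, ∃ G : Set LDTree, G.Finite ∧
      (∀ U ∈ G, U.WF ∧ U.dft ≤ s ∧ (U.deg = 0 → U.dft < s)) ∧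
      ∀ n m : ℕ, T.1.Rep n m → m - 3 * Real.logb 3 n < s → ∃ U ∈ G, U.Rep n m :=
    fun T => LDTree.exists_finite_truncation s (hwf T T.2)
  choose G hG hG' hGc using key
  have : Finite F := hF
  have hG'' : ∀ U ∈ ⋃ T, G T, U.WF ∧ U.dft ≤ s ∧ (U.deg = 0 → U.dft < s) := by
    intro U hU
    obtain ⟨T, hT⟩ := Set.mem_iUnion.1 hU
    exact hG' T U hT
  refine ⟨(fun T => (T.poly, T.base)) '' ⋃ T, G T, (Set.finite_iUnion hG).image _, ?_, ?_, ?_⟩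
  · rintro _ ⟨U, hU, rfl⟩
    exact ⟨U.deg, LDTree.ldp (hG'' U hU).1⟩
  · intro n hl hd
    obtain ⟨T, hT, hr⟩ := hcov n hl hd
    obtain ⟨U, hU, hr'⟩ := hGc ⟨T, hT⟩ n _ hr hd
    have hU' := Set.mem_iUnion.2 ⟨_, hU⟩
    exact ⟨_, ⟨U, hU', rfl⟩, U.deg, LDTree.ldp (hG'' U hU').1, hr'.effRep⟩
  · rintro _ ⟨U, hU, rfl⟩ r hr
    obtain ⟨hw, hle, hlt⟩ := hG'' U hU
    have hld := LDTree.ldp hw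
    obtain rfl : r = U.deg := le_antisymm (hr.degree_le hld) (hld.degree_le hr)
    have hdft : pairDft U.deg U.poly U.base = U.dft := by
      simp [pairDft, LDTree.dft, LDTree.leadCoeff_poly hw]
    dsimp only
    rw [hdft]
    exact ⟨hle, Nat.le_floor ((LDTree.deg_le_dft hw).trans hle), hlt⟩
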